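/- Let θ = [[0, I_n],[−I_n, 0]], let A and E be real 2n×2n matrices, let R be a real symmetric positive definite 2n×2n matrix, let γ > 0, and let X be a real symmetric positive definite 2n×2n matrix. If the complex Hermitian block matrix [[AᵀX + XA + (1/γ²)EᵀE + R, 4iXθEᵀ],[4iEθX, −I]] is negative definite, then AᵀX + XA + 16XθᵀEᵀEθX + (1/γ²)EᵀE + R is negative definite and A is Hurwitz. -/

import Mathlib

open Matrix
open scoped ComplexOrder

namespace Matrix

variable {m n 𝕜 : Type*} [Fintype m] [Fintype n] [RCLike 𝕜]

/-- The Schur complement of an identity block in a positive definite matrix is positive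
definite. -/
theorem PosDef.sub_mul_conjTranspose_of_fromBlocks_one [DecidableEq m] [DecidableEq n]
    {P : Matrix m m 𝕜} {B : Matrix m n 𝕜} (h : (fromBlocks P B Bᴴ 1).PosDef) :
    (P - B * Bᴴ).PosDef := by
  have hinj : Function.Injective (fromRows (1 : Matrix m m 𝕜) (-Bᴴ)).mulVec := by
    intro x y hxy
    funext i
    simpa [fromRows_mulVec] using congrFun hxy (Sum.inl i)
  have key := h.conjTranspose_mul_mul_same hinj
  rw [Matrix.mul_assoc, fromBlocks_mul_fromRows, conjTranspose_fromRows_eq_fromCols_conjTranspose,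
    fromCols_mul_fromRows] at key
  simpa [sub_eq_add_neg] using key

theorem posDef_map_ofReal_iff {M : Matrix n n ℝ} :
    (M.map Complex.ofReal).PosDef ↔ M.PosDef := by
  classical
  constructor
  · intro h
    refine .of_dotProduct_mulVec_pos ?_ fun x hx => ?_
    · ext i j
      simpa using congrArg Complex.re (congrFun (congrFun h.1 i) j)
    · have hx' : Complex.ofReal ∘ x ≠ 0 := fun h0 =>
        hx <| funext fun i => Complex.ofReal_eq_zero.mp (congrFun h0 i)
      have hpos := h.dotProduct_mulVec_pos hx'
      have hmul : M.map Complex.ofReal *ᵥ (Complex.ofReal ∘ x) = Complex.ofReal ∘ (M *ᵥ x) :=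
        funext fun i => (RingHom.map_mulVec Complex.ofRealHom M x i).symm
      have hstar : star (Complex.ofReal ∘ x) = Complex.ofReal ∘ x := by
        ext i
        simp
      have hdot : (Complex.ofReal ∘ x) ⬝ᵥ (Complex.ofReal ∘ (M *ᵥ x)) =
          ((x ⬝ᵥ M *ᵥ x : ℝ) : ℂ) :=
        (RingHom.map_dotProduct Complex.ofRealHom x (M *ᵥ x)).symm
      rw [hmul, hstar, hdot] at hpos
      simpa using Complex.zero_lt_real.mp hpos
  · intro h
    have hsemi : (M.map Complex.ofReal).PosSemidef := by
      open scoped MatrixOrder in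
      obtain ⟨B, hB⟩ := CStarAlgebra.nonneg_iff_eq_star_mul_self.mp h.posSemidef.nonneg
      have hmap : M.map Complex.ofReal = (B.map Complex.ofReal)ᴴ * B.map Complex.ofReal := by
        rw [hB]
        ext i j
        simp [mul_apply]
      rw [hmap]
      exact posSemidef_conjTranspose_mul_self _
    have hunit : IsUnit (Complex.ofRealHom.mapMatrix M) := h.isUnit.map _
    exact hsemi.posDef_iff_isUnit.mpr hunit

/-- **Lyapunov's criterion**: if `X` and `-(Aᴴ * X + X * A)` are positive definite, then `A` is
Hurwitz. -/
theorem re_lt_zero_of_mem_spectrum_of_lyapunov [DecidableEq n] {A X : Matrix n n ℂ}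
    (hX : X.PosDef) (hA : (-(Aᴴ * X + X * A)).PosDef) {μ : ℂ} (hμ : μ ∈ spectrum ℂ A) :
    μ.re < 0 := by
  rw [← spectrum_toLin', ← Module.End.hasEigenvalue_iff_mem_spectrum] at hμ
  obtain ⟨v, hv⟩ := hμ.exists_hasEigenvector
  have hAv : A *ᵥ v = μ • v := by simpa using hv.apply_eq_smul
  have hXv := hX.dotProduct_mulVec_pos hv.2
  have hLv := hA.dotProduct_mulVec_pos hv.2
  have hform : star v ⬝ᵥ (-(Aᴴ * X + X * A)) *ᵥ v =
      ((-2 * μ.re : ℝ) : ℂ) * (star v ⬝ᵥ X *ᵥ v) := by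
    have hadj : star v ⬝ᵥ (Aᴴ * X) *ᵥ v = star μ * (star v ⬝ᵥ X *ᵥ v) := by
      rw [← mulVec_mulVec, dotProduct_mulVec, ← star_mulVec, hAv, star_smul, smul_dotProduct,
        smul_eq_mul]
    have hright : star v ⬝ᵥ (X * A) *ᵥ v = μ * (star v ⬝ᵥ X *ᵥ v) := by
      rw [← mulVec_mulVec, hAv, mulVec_smul, dotProduct_smul, smul_eq_mul]
    have hre : star μ + μ = ((2 * μ.re : ℝ) : ℂ) := by
      rw [add_comm]
      exact Complex.add_conj μ
    rw [neg_mulVec, dotProduct_neg, add_mulVec, dotProduct_add, hadj, hright, ← add_mul, hre]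
    push_cast
    ring
  rw [hform] at hLv
  have hre := (Complex.lt_def.mp hLv).1
  rw [Complex.re_ofReal_mul] at hre
  have hXre : 0 < (star v ⬝ᵥ X *ᵥ v).re := (Complex.lt_def.mp hXv).1
  have := pos_of_mul_pos_left hre hXre.le
  linarith

end Matrix

/-- **Theorem 1, matrix-analytic content.** Let `θ = [[0, I],[-I, 0]]`,
let `A`, `E` be real `2n × 2n` matrices, `R`, `X` real symmetric positive definite
`2n × 2n` matrices and `γ > 0`.  If the complex Hermitian block matrix
`[[AᵀX + XA + (1/γ²)EᵀE + R, 4i XθEᵀ], [4i EθX, -I]]` is negative definite, then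
`AᵀX + XA + 16XθᵀEᵀEθX + (1/γ²)EᵀE + R` is negative definite and `A` is Hurwitz. -/
theorem performance_analysis_LMI (n : ℕ)
    (θ : Matrix (Fin n ⊕ Fin n) (Fin n ⊕ Fin n) ℝ)
    (hθ : θ = Matrix.fromBlocks 0 1 (-1) 0)
    (A E R X : Matrix (Fin n ⊕ Fin n) (Fin n ⊕ Fin n) ℝ)
    (hR : R.PosDef) (hX : X.PosDef)
    (γ : ℝ) (hγ : 0 < γ)
    (h : (-(Matrix.fromBlocks
        ((Aᵀ * X + X * A + (1/γ^2) • (Eᵀ * E) + R).map Complex.ofReal)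
        ((4 * Complex.I) • ((X * θ * Eᵀ).map Complex.ofReal))
        ((4 * Complex.I) • ((E * θ * X).map Complex.ofReal))
        (-1))).PosDef) :
    (-(Aᵀ * X + X * A + (16 : ℝ) • (X * θᵀ * Eᵀ * E * θ * X)
        + (1/γ^2) • (Eᵀ * E) + R)).PosDef ∧
      ∀ μ ∈ spectrum ℂ (A.map Complex.ofReal), μ.re < 0 := by
  have hθt : θᵀ = -θ := by
    subst hθ
    simp [fromBlocks_transpose, fromBlocks_neg]
  have hXt : Xᵀ = X := hX.1
  have hcost : (-(Aᵀ * X + X * A + (16 : ℝ) • (X * θᵀ * Eᵀ * E * θ * X)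
      + (1/γ^2) • (Eᵀ * E) + R)).PosDef := by
    rw [← posDef_map_ofReal_iff]
    set Q := Aᵀ * X + X * A + (1/γ^2) • (Eᵀ * E) + R with hQ
    set B : Matrix (Fin n ⊕ Fin n) (Fin n ⊕ Fin n) ℂ :=
      -((4 * Complex.I) • ((X * θ * Eᵀ).map Complex.ofReal)) with hB
    have hBt : Bᴴ = -((4 * Complex.I) • ((E * θ * X).map Complex.ofReal)) := by
      have ht : (X * θ * Eᵀ)ᵀ = -(E * θ * X) := by
        simp [transpose_mul, hθt, hXt, Matrix.mul_assoc]
      ext i j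
      have hij : (X * θ * Eᵀ) j i = -(E * θ * X) i j := congrFun (congrFun ht i) j
      simp [hB, hij]
    rw [fromBlocks_neg, neg_neg, ← hB, ← hBt] at h
    have hBB : B * Bᴴ = ((16 : ℝ) • (X * θᵀ * Eᵀ * E * θ * X)).map Complex.ofReal := by
      have hprod : (X * θ * Eᵀ).map Complex.ofReal * (E * θ * X).map Complex.ofReal =
          (X * θ * Eᵀ * (E * θ * X)).map Complex.ofReal :=
        (Matrix.map_mul (f := Complex.ofRealHom)).symm
      have hI : 4 * Complex.I * (4 * Complex.I) = -16 := by
        linear_combination 16 * Complex.I_mul_I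
      have hassoc : X * θᵀ * Eᵀ * E * θ * X = -(X * θ * Eᵀ * (E * θ * X)) := by
        simp [hθt, Matrix.mul_assoc]
      rw [hBt, hB, neg_mul_neg, smul_mul_smul_comm, hprod, hI, hassoc]
      ext i j
      simp
    have hschur : (-(Aᵀ * X + X * A + (16 : ℝ) • (X * θᵀ * Eᵀ * E * θ * X)
        + (1/γ^2) • (Eᵀ * E) + R)).map Complex.ofReal = -(Q.map Complex.ofReal) - B * Bᴴ := by
      rw [hBB, hQ]
      ext i j
      simp
      ring
    rw [hschur]
    exact h.sub_mul_conjTranspose_of_fromBlocks_one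
  refine ⟨hcost, fun μ hμ => ?_⟩
  have hEE : (Eᵀ * E).PosSemidef := posSemidef_conjTranspose_mul_self E
  have hEθX : (X * θᵀ * Eᵀ * E * θ * X).PosSemidef := by
    have := posSemidef_conjTranspose_mul_self (E * θ * X)
    simpa [conjTranspose_eq_transpose_of_trivial, transpose_mul, hXt, Matrix.mul_assoc] using this
  have hlyap : (-(Aᵀ * X + X * A)).PosDef := by
    convert ((hcost.add_posSemidef (hEθX.smul (by norm_num : (0 : ℝ) ≤ 16))).add_posSemidef
      (hEE.smul (by positivity : 0 ≤ 1/γ^2))).add hR using 1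
    abel
  refine re_lt_zero_of_mem_spectrum_of_lyapunov (posDef_map_ofReal_iff.mpr hX) ?_ hμ
  convert posDef_map_ofReal_iff.mpr hlyap using 1
  ext i j
  simp [mul_apply]
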